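/- arXiv:2208.12351 — 2 statements merged into one kernel-verified Lean document; each statement's English description precedes it below -/
import Mathlib

section
/- Let d ∈ {2,3} and 1 ≤ q < ∞. For all ε > 0, α > 1 and z ∈ ℝ^d one has ∫_{ℝ^d} |Ψ_{ε,α}[z](x)|^q dx ≤ (1 + 1/log α)^q |z|^q ω_d (αε)^d, where ω_d is the volume of the unit ball of ℝ^d. In particular, for every α ≥ 2 there is a constant C = C(d,q) such that ‖Ψ_{ε,α}[z]‖_{L^q(ℝ^d)} ≤ C |z| (εα)^{d/q}. -/
open MeasureTheory

/-- The radial cut-off profile `f_{A,B}`. -/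
noncomputable def fAB (A B : ℝ) (z : ℝ) : ℝ :=
  if z < A then 1
  else if z ≤ B then (Real.log z - Real.log B) / (Real.log A - Real.log B)
  else 0

/-- The cut-off `η_{ε,α}(x) = f_{ε,αε}(|x|)` on `ℝ^d`. -/
noncomputable def eta (d : ℕ) (ε α : ℝ) (x : EuclideanSpace ℝ (Fin d)) : ℝ :=
  fAB ε (α * ε) ‖x‖

/-- The auxiliary field `v_z(x) = (z₂x₃, z₃x₁, z₁x₂)` (1-based indices). -/
noncomputable def vz (z x : EuclideanSpace ℝ (Fin 3)) : EuclideanSpace ℝ (Fin 3) :=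
  (WithLp.equiv 2 (Fin 3 → ℝ)).symm ![z 1 * x 2, z 2 * x 0, z 0 * x 1]

/-- Cross product of two vectors of `ℝ³`. -/
noncomputable def cross3 (a b : EuclideanSpace ℝ (Fin 3)) : EuclideanSpace ℝ (Fin 3) :=
  (WithLp.equiv 2 (Fin 3 → ℝ)).symm
    ![a 1 * b 2 - a 2 * b 1, a 2 * b 0 - a 0 * b 2, a 0 * b 1 - a 1 * b 0]

/-- The gradient `∇η_{ε,α}(x) = -x/(|x|² log α)` on the annulus. -/
noncomputable def gradEta3 (α : ℝ) (x : EuclideanSpace ℝ (Fin 3)) : EuclideanSpace ℝ (Fin 3) :=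
  -(1 / (‖x‖ ^ 2 * Real.log α)) • x

/-- The divergence-free cut-off field `Ψ_{ε,α}[z]` in dimension 3:
equal to `z` for `|x| ≤ ε`, to `η_{ε,α} z + ∇η_{ε,α} × v_z` for `ε < |x| < αε`,
and to `0` for `|x| ≥ αε`. -/
noncomputable def Psi3 (ε α : ℝ) (z x : EuclideanSpace ℝ (Fin 3)) : EuclideanSpace ℝ (Fin 3) :=
  if ‖x‖ ≤ ε then z
  else if ‖x‖ < α * ε then eta 3 ε α x • z + cross3 (gradEta3 α x) (vz z x)
  else 0

/-- Curl of a vector field on `ℝ³`, via Fréchet derivatives in coordinate directions. -/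
noncomputable def curl3 (F : EuclideanSpace ℝ (Fin 3) → EuclideanSpace ℝ (Fin 3))
    (x : EuclideanSpace ℝ (Fin 3)) : EuclideanSpace ℝ (Fin 3) :=
  (WithLp.equiv 2 (Fin 3 → ℝ)).symm
    ![fderiv ℝ F x (EuclideanSpace.single 1 1) 2 - fderiv ℝ F x (EuclideanSpace.single 2 1) 1,
      fderiv ℝ F x (EuclideanSpace.single 2 1) 0 - fderiv ℝ F x (EuclideanSpace.single 0 1) 2,
      fderiv ℝ F x (EuclideanSpace.single 0 1) 1 - fderiv ℝ F x (EuclideanSpace.single 1 1) 0]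

/-- Divergence of a vector field on `ℝ³`. -/
noncomputable def div3 (F : EuclideanSpace ℝ (Fin 3) → EuclideanSpace ℝ (Fin 3))
    (x : EuclideanSpace ℝ (Fin 3)) : ℝ :=
  ∑ i, fderiv ℝ F x (EuclideanSpace.single i 1) i
/-- The scalar field `g_z(x) = z₂x₁ − z₁x₂` (1-based indices). -/
noncomputable def gz (z x : EuclideanSpace ℝ (Fin 2)) : ℝ := z 1 * x 0 - z 0 * x 1

/-- The perpendicular gradient `∇⊥h = (-∂₂h, ∂₁h)` of a scalar field on `ℝ²`. -/
noncomputable def perpGrad (h : EuclideanSpace ℝ (Fin 2) → ℝ) (x : EuclideanSpace ℝ (Fin 2)) :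
    EuclideanSpace ℝ (Fin 2) :=
  (WithLp.equiv 2 (Fin 2 → ℝ)).symm
    ![-(fderiv ℝ h x (EuclideanSpace.single 1 1)), fderiv ℝ h x (EuclideanSpace.single 0 1)]

/-- `∇⊥η_{ε,α}(x)` on the annulus, computed from `∇η_{ε,α}(x) = -x/(|x|² log α)`. -/
noncomputable def perpGradEta2 (α : ℝ) (x : EuclideanSpace ℝ (Fin 2)) :
    EuclideanSpace ℝ (Fin 2) :=
  (WithLp.equiv 2 (Fin 2 → ℝ)).symm
    ![x 1 / (‖x‖ ^ 2 * Real.log α), -(x 0) / (‖x‖ ^ 2 * Real.log α)]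

/-- The divergence-free cut-off field `Ψ_{ε,α}[z]` in dimension 2:
equal to `z` for `|x| ≤ ε`, to `η_{ε,α} z + g_z ∇⊥η_{ε,α}` for `ε < |x| < αε`,
and to `0` for `|x| ≥ αε`. -/
noncomputable def Psi2 (ε α : ℝ) (z x : EuclideanSpace ℝ (Fin 2)) : EuclideanSpace ℝ (Fin 2) :=
  if ‖x‖ ≤ ε then z
  else if ‖x‖ < α * ε then eta 2 ε α x • z + gz z x • perpGradEta2 α x
  else 0

/-- Divergence of a vector field on `ℝ²`. -/
noncomputable def div2 (F : EuclideanSpace ℝ (Fin 2) → EuclideanSpace ℝ (Fin 2))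
    (x : EuclideanSpace ℝ (Fin 2)) : ℝ :=
  ∑ i, fderiv ℝ F x (EuclideanSpace.single i 1) i

lemma eta_bound (d : ℕ) (ε α : ℝ) (hε : 0 < ε) (hα : 1 < α) (x : EuclideanSpace ℝ (Fin d))
    (h1 : ε < ‖x‖) (h2 : ‖x‖ < α * ε) : |eta d ε α x| ≤ 1 := by
  have hx : 0 < ‖x‖ := hε.trans h1
  have l1 : Real.log ε < Real.log ‖x‖ := Real.log_lt_log hε h1
  have l2 : Real.log ‖x‖ < Real.log (α * ε) := Real.log_lt_log hx h2
  unfold eta fAB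
  rw [if_neg (not_lt.mpr h1.le), if_pos h2.le, abs_div, div_le_one (by rw [abs_pos]; linarith),
    abs_of_neg (by linarith), abs_of_neg (by linarith)]
  linarith

lemma cross3_norm_le (a b : EuclideanSpace ℝ (Fin 3)) : ‖cross3 a b‖ ≤ ‖a‖ * ‖b‖ := by
  refine (pow_le_pow_iff_left₀ (norm_nonneg _) (by positivity) two_ne_zero).mp ?_
  rw [mul_pow, EuclideanSpace.real_norm_sq_eq, EuclideanSpace.real_norm_sq_eq,
    EuclideanSpace.real_norm_sq_eq]
  simp only [Fin.sum_univ_three, cross3, WithLp.equiv_symm_apply, Matrix.cons_val]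
  nlinarith [sq_nonneg (a 0 * b 0 + a 1 * b 1 + a 2 * b 2)]

lemma vz_norm_le (z x : EuclideanSpace ℝ (Fin 3)) : ‖vz z x‖ ≤ ‖z‖ * ‖x‖ := by
  refine (pow_le_pow_iff_left₀ (norm_nonneg _) (by positivity) two_ne_zero).mp ?_
  rw [mul_pow, EuclideanSpace.real_norm_sq_eq, EuclideanSpace.real_norm_sq_eq,
    EuclideanSpace.real_norm_sq_eq]
  simp only [Fin.sum_univ_three, vz, WithLp.equiv_symm_apply, Matrix.cons_val]
  nlinarith [sq_nonneg (z 0 * x 0), sq_nonneg (z 1 * x 1), sq_nonneg (z 2 * x 2),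
    sq_nonneg (z 0 * x 2), sq_nonneg (z 1 * x 0), sq_nonneg (z 2 * x 1)]

lemma gz_abs_le (z x : EuclideanSpace ℝ (Fin 2)) : |gz z x| ≤ ‖z‖ * ‖x‖ := by
  apply abs_le_of_sq_le_sq _ (by positivity)
  rw [mul_pow, EuclideanSpace.real_norm_sq_eq, EuclideanSpace.real_norm_sq_eq]
  simp only [Fin.sum_univ_two, gz]
  nlinarith [sq_nonneg (z 0 * x 0 + z 1 * x 1)]

lemma perp_norm (α : ℝ) (hα : 1 < α) (x : EuclideanSpace ℝ (Fin 2)) (hx : 0 < ‖x‖) :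
    ‖perpGradEta2 α x‖ = 1 / (‖x‖ * Real.log α) := by
  have hl : 0 < Real.log α := Real.log_pos hα
  have h : ‖perpGradEta2 α x‖ ^ 2 = (1 / (‖x‖ * Real.log α)) ^ 2 := by
    rw [EuclideanSpace.real_norm_sq_eq]
    have hs : ‖x‖ ^ 2 = x 0 ^ 2 + x 1 ^ 2 := by
      rw [EuclideanSpace.real_norm_sq_eq, Fin.sum_univ_two]
    simp only [Fin.sum_univ_two, perpGradEta2, WithLp.equiv_symm_apply, Matrix.cons_val]
    have : (x 1 / (‖x‖ ^ 2 * Real.log α)) ^ 2 + (-(x 0) / (‖x‖ ^ 2 * Real.log α)) ^ 2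
        = (x 0 ^ 2 + x 1 ^ 2) / (‖x‖ ^ 2 * Real.log α) ^ 2 := by ring
    rw [this, ← hs]
    field_simp
  exact (pow_left_inj₀ (norm_nonneg _) (by positivity) two_ne_zero).mp h

lemma Psi2_bound (ε α : ℝ) (hε : 0 < ε) (hα : 1 < α) (z x : EuclideanSpace ℝ (Fin 2)) :
    ‖Psi2 ε α z x‖ ≤ (1 + 1 / Real.log α) * ‖z‖ := by
  have hl : 0 < Real.log α := Real.log_pos hα
  have hz := norm_nonneg z
  unfold Psi2
  split_ifs with h1 h2
  · have : 0 ≤ 1 / Real.log α * ‖z‖ := by positivity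
    linarith
  · push Not at h1
    have hx : 0 < ‖x‖ := hε.trans h1
    have he := eta_bound 2 ε α hε hα x h1 h2
    refine (norm_add_le _ _).trans ?_
    rw [norm_smul, norm_smul, perp_norm α hα x hx, Real.norm_eq_abs, Real.norm_eq_abs]
    have a1 : |eta 2 ε α x| * ‖z‖ ≤ 1 * ‖z‖ := by gcongr
    have a2 : |gz z x| * (1 / (‖x‖ * Real.log α)) ≤ ‖z‖ * ‖x‖ * (1 / (‖x‖ * Real.log α)) := by
      gcongr
      exact gz_abs_le z x
    have a3 : ‖z‖ * ‖x‖ * (1 / (‖x‖ * Real.log α)) = 1 / Real.log α * ‖z‖ := by field_simp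
    linarith
  · rw [norm_zero]; positivity

lemma Psi3_bound (ε α : ℝ) (hε : 0 < ε) (hα : 1 < α) (z x : EuclideanSpace ℝ (Fin 3)) :
    ‖Psi3 ε α z x‖ ≤ (1 + 1 / Real.log α) * ‖z‖ := by
  have hl : 0 < Real.log α := Real.log_pos hα
  have hz := norm_nonneg z
  unfold Psi3
  split_ifs with h1 h2
  · have : 0 ≤ 1 / Real.log α * ‖z‖ := by positivity
    linarith
  · push Not at h1
    have hx : 0 < ‖x‖ := hε.trans h1
    have he := eta_bound 3 ε α hε hα x h1 h2
    refine (norm_add_le _ _).trans ?_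
    rw [norm_smul, Real.norm_eq_abs]
    have a1 : |eta 3 ε α x| * ‖z‖ ≤ 1 * ‖z‖ := by gcongr
    have g : ‖gradEta3 α x‖ = 1 / (‖x‖ * Real.log α) := by
      unfold gradEta3
      rw [norm_smul, norm_neg, Real.norm_eq_abs, abs_of_pos (by positivity)]
      field_simp
    have a2 : ‖cross3 (gradEta3 α x) (vz z x)‖ ≤ 1 / (‖x‖ * Real.log α) * (‖z‖ * ‖x‖) := by
      refine (cross3_norm_le _ _).trans ?_
      rw [g]
      gcongr
      exact vz_norm_le z x
    have a3 : 1 / (‖x‖ * Real.log α) * (‖z‖ * ‖x‖) = 1 / Real.log α * ‖z‖ := by field_simp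
    linarith
  · rw [norm_zero]; positivity

lemma Psi2_zero (ε α : ℝ) (hε : 0 < ε) (hα : 1 < α) (z x : EuclideanSpace ℝ (Fin 2))
    (h : α * ε ≤ ‖x‖) : Psi2 ε α z x = 0 := by
  unfold Psi2
  rw [if_neg (by nlinarith), if_neg (by linarith)]

lemma Psi3_zero (ε α : ℝ) (hε : 0 < ε) (hα : 1 < α) (z x : EuclideanSpace ℝ (Fin 3))
    (h : α * ε ≤ ‖x‖) : Psi3 ε α z x = 0 := by
  unfold Psi3
  rw [if_neg (by nlinarith), if_neg (by linarith)]

lemma int_bound (d : ℕ) (q : ℝ) (hq : 1 ≤ q) (K Z R : ℝ) (hK : 0 ≤ K) (hZ : 0 ≤ Z) (hR : 0 < R)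
    (F : EuclideanSpace ℝ (Fin d) → EuclideanSpace ℝ (Fin d))
    (hF : ∀ x, ‖F x‖ ≤ K * Z) (hF0 : ∀ x, R ≤ ‖x‖ → F x = 0) :
    (∫ x, ‖F x‖ ^ q) ≤ K ^ q * Z ^ q *
      ((volume (Metric.ball (0 : EuclideanSpace ℝ (Fin d)) 1)).toReal * R ^ d) := by
  have hfin : volume (Metric.ball (0 : EuclideanSpace ℝ (Fin d)) R) ≠ ⊤ := measure_ball_lt_top.ne
  have key : (∫ x, ‖F x‖ ^ q) ≤
      ∫ x, (Metric.ball (0 : EuclideanSpace ℝ (Fin d)) R).indicator (fun _ => (K * Z) ^ q) x := by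
    apply integral_mono_of_nonneg
    · exact Filter.Eventually.of_forall fun x => by positivity
    · exact (integrable_indicator_iff measurableSet_ball).mpr (integrableOn_const hfin)
    · refine Filter.Eventually.of_forall fun x => ?_
      by_cases hx : ‖x‖ < R
      · rw [Set.indicator_of_mem (by simpa using hx)]
        exact Real.rpow_le_rpow (norm_nonneg _) (hF x) (by linarith)
      · rw [Set.indicator_of_notMem (by simpa using hx)]
        simp only [hF0 x (not_lt.mp hx), norm_zero]
        rw [Real.zero_rpow (by linarith)]
  refine key.trans (le_of_eq ?_)
  rw [integral_indicator measurableSet_ball, setIntegral_const, smul_eq_mul, Measure.real,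
    Measure.addHaar_ball_of_pos _ _ hR, ENNReal.toReal_mul, ENNReal.toReal_ofReal (by positivity),
    Real.mul_rpow hK hZ, finrank_euclideanSpace, Fintype.card_fin]
  ring

lemma root_bound (d : ℕ) (q : ℝ) (hq : 1 ≤ q) (K L Z R w I : ℝ) (hK : 0 ≤ K) (hKL : K ≤ L)
    (hZ : 0 ≤ Z) (hR : 0 < R) (hw : 0 ≤ w) (hI0 : 0 ≤ I) (hI : I ≤ K ^ q * Z ^ q * (w * R ^ d)) :
    I ^ (1 / q) ≤ L * w ^ (1 / q) * Z * R ^ ((d : ℝ) / q) := by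
  have hq0 : q ≠ 0 := by linarith
  calc I ^ (1 / q) ≤ (K ^ q * Z ^ q * (w * R ^ d)) ^ (1 / q) :=
        Real.rpow_le_rpow hI0 hI (by positivity)
    _ = K * Z * (w ^ (1 / q) * R ^ ((d : ℝ) / q)) := by
        rw [Real.mul_rpow (by positivity) (by positivity),
          Real.mul_rpow (by positivity) (by positivity),
          Real.mul_rpow hw (by positivity), one_div, Real.rpow_rpow_inv hK hq0,
          Real.rpow_rpow_inv hZ hq0, ← Real.rpow_natCast R d, ← Real.rpow_mul hR.le, div_eq_mul_inv]
    _ ≤ L * Z * (w ^ (1 / q) * R ^ ((d : ℝ) / q)) := by gcongr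
    _ = _ := by ring

lemma log_bound (α : ℝ) (hα : 2 ≤ α) : 1 + 1 / Real.log α ≤ 1 + 1 / Real.log 2 := by
  have h2 : 0 < Real.log 2 := Real.log_pos (by norm_num)
  have := Real.log_le_log (by norm_num) hα
  gcongr

lemma ball_pos (d : ℕ) :
    0 < (volume (Metric.ball (0 : EuclideanSpace ℝ (Fin d)) 1)).toReal :=
  ENNReal.toReal_pos (Metric.measure_ball_pos _ _ one_pos).ne' measure_ball_lt_top.ne

/-- For `d ∈ {2,3}` and `1 ≤ q < ∞`:
`∫_{ℝ^d} |Ψ_{ε,α}[z]|^q ≤ (1 + 1/log α)^q |z|^q ω_d (αε)^d`, and for `α ≥ 2` there is a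
constant `C = C(d,q)` with `‖Ψ_{ε,α}[z]‖_{L^q} ≤ C |z| (εα)^{d/q}`. -/
theorem Psi_Lq_bound (q : ℝ) (hq : 1 ≤ q) :
    (∀ ε α : ℝ, 0 < ε → 1 < α → ∀ z : EuclideanSpace ℝ (Fin 2),
      (∫ x : EuclideanSpace ℝ (Fin 2), ‖Psi2 ε α z x‖ ^ q)
        ≤ (1 + 1 / Real.log α) ^ q * ‖z‖ ^ q *
            ((volume (Metric.ball (0 : EuclideanSpace ℝ (Fin 2)) 1)).toReal * (α * ε) ^ 2)) ∧
    (∀ ε α : ℝ, 0 < ε → 1 < α → ∀ z : EuclideanSpace ℝ (Fin 3),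
      (∫ x : EuclideanSpace ℝ (Fin 3), ‖Psi3 ε α z x‖ ^ q)
        ≤ (1 + 1 / Real.log α) ^ q * ‖z‖ ^ q *
            ((volume (Metric.ball (0 : EuclideanSpace ℝ (Fin 3)) 1)).toReal * (α * ε) ^ 3)) ∧
    (∃ C : ℝ, 0 < C ∧ ∀ ε α : ℝ, 0 < ε → 2 ≤ α → ∀ z : EuclideanSpace ℝ (Fin 2),
      (∫ x : EuclideanSpace ℝ (Fin 2), ‖Psi2 ε α z x‖ ^ q) ^ (1 / q)
        ≤ C * ‖z‖ * (ε * α) ^ ((2 : ℝ) / q)) ∧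
    (∃ C : ℝ, 0 < C ∧ ∀ ε α : ℝ, 0 < ε → 2 ≤ α → ∀ z : EuclideanSpace ℝ (Fin 3),
      (∫ x : EuclideanSpace ℝ (Fin 3), ‖Psi3 ε α z x‖ ^ q) ^ (1 / q)
        ≤ C * ‖z‖ * (ε * α) ^ ((3 : ℝ) / q)) := by
  have hK : ∀ α : ℝ, 1 < α → 0 ≤ 1 + 1 / Real.log α := fun α hα => by
    have := Real.log_pos hα
    positivity
  have P2 : ∀ ε α : ℝ, 0 < ε → 1 < α → ∀ z : EuclideanSpace ℝ (Fin 2),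
      (∫ x : EuclideanSpace ℝ (Fin 2), ‖Psi2 ε α z x‖ ^ q)
        ≤ (1 + 1 / Real.log α) ^ q * ‖z‖ ^ q *
            ((volume (Metric.ball (0 : EuclideanSpace ℝ (Fin 2)) 1)).toReal * (α * ε) ^ 2) :=
    fun ε α hε hα z => int_bound 2 q hq _ _ _ (hK α hα) (norm_nonneg z) (by positivity) _
      (Psi2_bound ε α hε hα z) (Psi2_zero ε α hε hα z)
  have P3 : ∀ ε α : ℝ, 0 < ε → 1 < α → ∀ z : EuclideanSpace ℝ (Fin 3),
      (∫ x : EuclideanSpace ℝ (Fin 3), ‖Psi3 ε α z x‖ ^ q)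
        ≤ (1 + 1 / Real.log α) ^ q * ‖z‖ ^ q *
            ((volume (Metric.ball (0 : EuclideanSpace ℝ (Fin 3)) 1)).toReal * (α * ε) ^ 3) :=
    fun ε α hε hα z => int_bound 3 q hq _ _ _ (hK α hα) (norm_nonneg z) (by positivity) _
      (Psi3_bound ε α hε hα z) (Psi3_zero ε α hε hα z)
  have h2 : 0 < Real.log 2 := Real.log_pos (by norm_num)
  refine ⟨P2, P3, ⟨(1 + 1 / Real.log 2) *
      (volume (Metric.ball (0 : EuclideanSpace ℝ (Fin 2)) 1)).toReal ^ (1 / q), ?_, ?_⟩,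
    ⟨(1 + 1 / Real.log 2) *
      (volume (Metric.ball (0 : EuclideanSpace ℝ (Fin 3)) 1)).toReal ^ (1 / q), ?_, ?_⟩⟩
  · have := ball_pos 2
    positivity
  · intro ε α hε hα z
    have hα1 : 1 < α := by linarith
    rw [mul_comm ε α]
    have := root_bound 2 q hq _ _ _ _ _ _ (hK α hα1) (log_bound α hα) (norm_nonneg z)
      (by positivity) (ball_pos 2).le (integral_nonneg fun x => by positivity) (P2 ε α hε hα1 z)
    exact_mod_cast this
  · have := ball_pos 3
    positivity
  · intro ε α hε hα z
    have hα1 : 1 < α := by linarith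
    rw [mul_comm ε α]
    have := root_bound 3 q hq _ _ _ _ _ _ (hK α hα1) (log_bound α hα) (norm_nonneg z)
      (by positivity) (ball_pos 3).le (integral_nonneg fun x => by positivity) (P3 ε α hε hα1 z)
    exact_mod_cast this
end

section
/- For every real 1 ≤ q < 2 there is a constant C = C(q) > 0 such that for all ε > 0, α > 1 and z ∈ ℝ², ∫_{{x ∈ ℝ² : ε < |x| < αε}} ‖DΨ_{ε,α}[z](x)‖^q dx ≤ C |z|^q · (α^{2−q} − 1) ε^{2−q} / ((2−q) (log α)^q), where DΨ denotes the Fréchet derivative of Ψ_{ε,α}[z] on the annulus and ‖·‖ the operator norm (one may take C = 5^q · 2π). -/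
open MeasureTheory

/-- Rotation `J x = (x₁, -x₀)` as a continuous linear map. -/
noncomputable def rotJ : EuclideanSpace ℝ (Fin 2) →L[ℝ] EuclideanSpace ℝ (Fin 2) :=
  LinearMap.toContinuousLinearMap
    { toFun := fun x => !₂[x 1, -(x 0)]
      map_add' := by
        intro x y
        ext i
        fin_cases i <;> simp [add_comm]
      map_smul' := by
        intro c x
        ext i
        fin_cases i <;> simp }

lemma rotJ_apply (x : EuclideanSpace ℝ (Fin 2)) : rotJ x = !₂[x 1, -(x 0)] := rfl

lemma rotJ_norm (x : EuclideanSpace ℝ (Fin 2)) : ‖rotJ x‖ = ‖x‖ := by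
  rw [rotJ_apply, EuclideanSpace.norm_eq, EuclideanSpace.norm_eq]
  simp [Fin.sum_univ_two, add_comm]

/-- `g_z` as a continuous linear form. -/
noncomputable def gL (z : EuclideanSpace ℝ (Fin 2)) : EuclideanSpace ℝ (Fin 2) →L[ℝ] ℝ :=
  -((innerSL ℝ z).comp rotJ)

lemma gL_apply (z x : EuclideanSpace ℝ (Fin 2)) : gL z x = gz z x := by
  simp [gL, gz, rotJ_apply, PiLp.inner_apply, Fin.sum_univ_two]
  ring

lemma gL_bound (z x : EuclideanSpace ℝ (Fin 2)) : |gL z x| ≤ ‖z‖ * ‖x‖ := by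
  have h := abs_real_inner_le_norm z (rotJ x)
  rw [rotJ_norm] at h
  simpa [gL] using h

lemma Psi2_eq {ε α : ℝ} (hε : 0 < ε) (hα : 1 < α) (z x : EuclideanSpace ℝ (Fin 2))
    (h1 : ε < ‖x‖) (h2 : ‖x‖ < α * ε) :
    Psi2 ε α z x = (Real.log α)⁻¹ • ((Real.log (α * ε) - 2⁻¹ * Real.log (‖x‖ ^ 2)) • z
      + (gL z x * (‖x‖ ^ 2)⁻¹) • rotJ x) := by
  have hl : 0 < Real.log α := Real.log_pos hα
  have hx : 0 < ‖x‖ := hε.trans h1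
  have hlog : Real.log (α * ε) = Real.log α + Real.log ε :=
    Real.log_mul (by positivity) (by positivity)
  have e1 : eta 2 ε α x = (Real.log α)⁻¹ * (Real.log (α * ε) - 2⁻¹ * Real.log (‖x‖ ^ 2)) := by
    rw [eta, fAB, if_neg (not_lt.2 h1.le), if_pos h2.le, Real.log_pow, hlog]
    have : Real.log ε - (Real.log α + Real.log ε) = - Real.log α := by ring
    rw [this]
    push_cast
    field_simp
    ring
  have e2 : perpGradEta2 α x = ((Real.log α)⁻¹ * (‖x‖ ^ 2)⁻¹) • rotJ x := by
    ext i
    fin_cases i <;> simp [perpGradEta2, rotJ_apply] <;> field_simp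
  rw [Psi2, if_neg (not_le.2 h1), if_pos h2, e1, e2, gL_apply]
  module

lemma fderiv_bound {ε α : ℝ} (hε : 0 < ε) (hα : 1 < α) (z x : EuclideanSpace ℝ (Fin 2))
    (h1 : ε < ‖x‖) (h2 : ‖x‖ < α * ε) :
    ‖fderiv ℝ (Psi2 ε α z) x‖ ≤ 5 * ‖z‖ / Real.log α * ‖x‖⁻¹ := by
  have hl : 0 < Real.log α := Real.log_pos hα
  have hx : 0 < ‖x‖ := hε.trans h1
  have hx2 : ‖x‖ ^ 2 ≠ 0 := by positivity
  have hopen : {y : EuclideanSpace ℝ (Fin 2) | ε < ‖y‖ ∧ ‖y‖ < α * ε} ∈ nhds x :=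
    ((isOpen_lt continuous_const continuous_norm).inter
      (isOpen_lt continuous_norm continuous_const)).mem_nhds ⟨h1, h2⟩
  have hev : Psi2 ε α z =ᶠ[nhds x] fun x => (Real.log α)⁻¹ •
      ((Real.log (α * ε) - 2⁻¹ * Real.log (‖x‖ ^ 2)) • z
      + (gL z x * (‖x‖ ^ 2)⁻¹) • rotJ x) := by
    filter_upwards [hopen] with y hy using Psi2_eq hε hα z y hy.1 hy.2
  have hN : HasFDerivAt (fun y : EuclideanSpace ℝ (Fin 2) => ‖y‖ ^ 2) (2 • innerSL ℝ x) x :=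
    (hasStrictFDerivAt_norm_sq x).hasFDerivAt
  have hlogN := hN.log hx2
  have hinv := (hasDerivAt_inv hx2).comp_hasFDerivAt x hN
  have hA := ((hlogN.const_mul (2⁻¹ : ℝ)).const_sub (Real.log (α * ε))).smul_const z
  have hB := ((gL z).hasFDerivAt (x := x)).mul hinv
  have hC := hB.smul (rotJ.hasFDerivAt (x := x))
  have hD := (hA.add hC).const_smul (Real.log α)⁻¹
  rw [hev.fderiv_eq]
  refine (congrArg norm (HasFDerivAt.fderiv hD)).trans_le ?_
  refine ContinuousLinearMap.opNorm_le_bound _ (by positivity) fun v => ?_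
  set G := gL z with hG
  set r := ‖x‖ with hr
  have hi : |inner ℝ x v| ≤ r * ‖v‖ := abs_real_inner_le_norm x v
  have g1 := gL_bound z x
  have g2 := gL_bound z v
  rw [← hG] at g1 g2
  rw [← hr] at g1
  have key : ‖-(inner ℝ x v * (r ^ 2)⁻¹) • z + ((G v * (r ^ 2)⁻¹) • rotJ x
      + ((-(2 * G x * inner ℝ x v * (r ^ 4)⁻¹)) • rotJ x + (G x * (r ^ 2)⁻¹) • rotJ v))‖
      ≤ 5 * ‖z‖ * r⁻¹ * ‖v‖ := by
    have b1 : ‖-(inner ℝ x v * (r ^ 2)⁻¹) • z‖ ≤ ‖z‖ * r⁻¹ * ‖v‖ := by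
      rw [norm_smul, norm_neg, norm_mul, Real.norm_eq_abs, Real.norm_of_nonneg (by positivity)]
      calc _ ≤ (r * ‖v‖) * (r ^ 2)⁻¹ * ‖z‖ := by gcongr
        _ = _ := by field_simp
    have b2 : ‖(G v * (r ^ 2)⁻¹) • rotJ x‖ ≤ ‖z‖ * r⁻¹ * ‖v‖ := by
      rw [norm_smul, norm_mul, Real.norm_eq_abs, Real.norm_of_nonneg (by positivity), rotJ_norm]
      calc _ ≤ (‖z‖ * ‖v‖) * (r ^ 2)⁻¹ * r := by gcongr
        _ = _ := by field_simp
    have b3 : ‖(-(2 * G x * inner ℝ x v * (r ^ 4)⁻¹)) • rotJ x‖ ≤ 2 * (‖z‖ * r⁻¹ * ‖v‖) := by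
      rw [norm_smul, norm_neg, norm_mul, norm_mul, norm_mul, Real.norm_eq_abs (G x),
        Real.norm_eq_abs (inner ℝ x v), Real.norm_of_nonneg (by positivity : 0 ≤ (r ^ 4)⁻¹),
        Real.norm_of_nonneg (by norm_num : (0:ℝ) ≤ 2), rotJ_norm]
      calc _ ≤ 2 * (‖z‖ * r) * (r * ‖v‖) * (r ^ 4)⁻¹ * r := by gcongr
        _ = _ := by field_simp
    have b4 : ‖(G x * (r ^ 2)⁻¹) • rotJ v‖ ≤ ‖z‖ * r⁻¹ * ‖v‖ := by
      rw [norm_smul, norm_mul, Real.norm_eq_abs, Real.norm_of_nonneg (by positivity), rotJ_norm]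
      calc _ ≤ (‖z‖ * r) * (r ^ 2)⁻¹ * ‖v‖ := by gcongr
        _ = _ := by field_simp
    refine (norm_add_le_of_le b1 (norm_add_le_of_le b2 (norm_add_le_of_le b3 b4))).trans
      (le_of_eq (by ring))
  calc _ = ‖(Real.log α)⁻¹ • (-(inner ℝ x v * (r ^ 2)⁻¹) • z + ((G v * (r ^ 2)⁻¹) • rotJ x
      + ((-(2 * G x * inner ℝ x v * (r ^ 4)⁻¹)) • rotJ x + (G x * (r ^ 2)⁻¹) • rotJ v)))‖ := by
        congr 1
        simp
        rw [← hr]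
        match_scalars <;> field_simp <;> ring
    _ = (Real.log α)⁻¹ * _ := by rw [norm_smul, Real.norm_of_nonneg (by positivity)]
    _ ≤ (Real.log α)⁻¹ * (5 * ‖z‖ * r⁻¹ * ‖v‖) := by gcongr
    _ = _ := by field_simp

lemma annulus_integral (q : ℝ) (hq2 : q < 2) {ε α : ℝ} (hε : 0 < ε) (hα : 1 < α) :
    (∫ x in {x : EuclideanSpace ℝ (Fin 2) | ε < ‖x‖ ∧ ‖x‖ < α * ε}, ‖x‖ ^ (-q))
      = 2 * volume.real (Metric.ball (0 : EuclideanSpace ℝ (Fin 2)) 1) *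
        ((α ^ (2 - q) - 1) * ε ^ (2 - q) / (2 - q)) := by
  have hm : MeasurableSet {x : EuclideanSpace ℝ (Fin 2) | ε < ‖x‖ ∧ ‖x‖ < α * ε} :=
    ((isOpen_lt continuous_const continuous_norm).inter
      (isOpen_lt continuous_norm continuous_const)).measurableSet
  rw [← integral_indicator hm]
  have h := integral_fun_norm_addHaar (volume : Measure (EuclideanSpace ℝ (Fin 2)))
    ((Set.Ioo ε (α * ε)).indicator fun r : ℝ => r ^ (-q))
  have hle : ε ≤ α * ε := by nlinarith
  have e : ∫ y in Set.Ioi (0:ℝ), y ^ (2 - 1) • (Set.Ioo ε (α * ε)).indicator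
      (fun r : ℝ => r ^ (-q)) y = (α ^ (2 - q) - 1) * ε ^ (2 - q) / (2 - q) := by
    have : ∀ y : ℝ, y ^ (2 - 1) • (Set.Ioo ε (α * ε)).indicator
      (fun r : ℝ => r ^ (-q)) y = (Set.Ioo ε (α * ε)).indicator (fun r : ℝ => r ^ (1-q)) y := by
      intro y
      by_cases hy : y ∈ Set.Ioo ε (α * ε)
      · rw [Set.indicator_of_mem hy, Set.indicator_of_mem hy, sub_eq_add_neg,
          Real.rpow_add (hε.trans hy.1)]
        simp
      · simp [hy]
    simp_rw [this]
    have hsub : Set.Ioo ε (α * ε) ⊆ Set.Ioi 0 := fun y hy => hε.trans hy.1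
    rw [setIntegral_indicator measurableSet_Ioo, Set.inter_eq_right.2
      hsub, ← integral_Ioc_eq_integral_Ioo,
      ← intervalIntegral.integral_of_le hle, integral_rpow (Or.inl (by linarith))]
    rw [show 1 - q + 1 = 2 - q by ring, Real.mul_rpow (by positivity) hε.le]
    ring
  simp only [finrank_euclideanSpace, Fintype.card_fin] at h
  rw [e] at h
  calc _ = _ := by rfl
    _ = _ := h
    _ = _ := by
      simp only [nsmul_eq_mul, smul_eq_mul]
      push_cast
      ring

/-- For `1 ≤ q < 2` the `L^q` bound of the derivative. -/
theorem Psi2_deriv_Lq_bound (q : ℝ) (hq1 : 1 ≤ q) (hq2 : q < 2) :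
    ∃ C : ℝ, 0 < C ∧ ∀ ε α : ℝ, 0 < ε → 1 < α → ∀ z : EuclideanSpace ℝ (Fin 2),
      (∫ x in {x : EuclideanSpace ℝ (Fin 2) | ε < ‖x‖ ∧ ‖x‖ < α * ε},
          ‖fderiv ℝ (Psi2 ε α z) x‖ ^ q)
        ≤ C * ‖z‖ ^ q * ((α ^ (2 - q) - 1) * ε ^ (2 - q) / ((2 - q) * Real.log α ^ q)) := by
  have hV : 0 < volume.real (Metric.ball (0 : EuclideanSpace ℝ (Fin 2)) 1) :=
    ENNReal.toReal_pos (Metric.measure_ball_pos _ _ one_pos).ne' measure_ball_lt_top.ne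
  refine ⟨5 ^ q * (2 * volume.real (Metric.ball (0 : EuclideanSpace ℝ (Fin 2)) 1)),
    by positivity, fun ε α hε hα z => ?_⟩
  have hl : 0 < Real.log α := Real.log_pos hα
  have hm : MeasurableSet {x : EuclideanSpace ℝ (Fin 2) | ε < ‖x‖ ∧ ‖x‖ < α * ε} :=
    ((isOpen_lt continuous_const continuous_norm).inter
      (isOpen_lt continuous_norm continuous_const)).measurableSet
  have hInt : IntegrableOn (fun x : EuclideanSpace ℝ (Fin 2) => ‖x‖ ^ (-q))
      {x : EuclideanSpace ℝ (Fin 2) | ε < ‖x‖ ∧ ‖x‖ < α * ε} := by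
    refine Integrable.of_integral_ne_zero ?_
    rw [annulus_integral q hq2 hε hα]
    have : 1 < α ^ (2 - q) := Real.one_lt_rpow hα (by linarith)
    have h2 : 0 < 2 - q := by linarith
    have h3 : 0 < α ^ (2 - q) - 1 := by linarith
    positivity
  calc _ ≤ ∫ x in {x : EuclideanSpace ℝ (Fin 2) | ε < ‖x‖ ∧ ‖x‖ < α * ε},
        (5 * ‖z‖ / Real.log α) ^ q * ‖x‖ ^ (-q) := by
        refine integral_mono_of_nonneg (Filter.Eventually.of_forall fun x => by positivity)
          (hInt.const_mul _) ?_
        filter_upwards [ae_restrict_mem hm] with x hx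
        have := Real.rpow_le_rpow (norm_nonneg _) (fderiv_bound hε hα z x hx.1 hx.2)
          (by linarith : 0 ≤ q)
        refine this.trans (le_of_eq ?_)
        rw [Real.mul_rpow (by positivity) (by positivity), Real.inv_rpow (norm_nonneg _),
          Real.rpow_neg (norm_nonneg _)]
    _ = _ := by
        rw [integral_const_mul, annulus_integral q hq2 hε hα,
          Real.div_rpow (by positivity) hl.le, Real.mul_rpow (by norm_num) (norm_nonneg _)]
        have : 0 < Real.log α ^ q := Real.rpow_pos_of_pos hl _
        field_simp
end
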